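/- (λvsub Stability of Meaningful Observables) Let k ∈ ℕ∪{ω} and T, U be partial terms of the λvsub-calculus. If T belongs to the grammar bno_k and T ≤ U, then U belongs to bno_k and T ≡_k U (stratified equality at level k). -/

import Mathlib

/-- `i`-fold composition of a relation: `nSteps R i a b` holds iff `a` goes to
`b` in exactly `i` `R`-steps. -/
def nSteps {α : Type} (R : α → α → Prop) : ℕ → α → α → Prop
  | 0, a, b => a = b
  | n + 1, a, b => ∃ c, R a c ∧ nSteps R n c b

/-- Terms of the λvsub-calculus (value substitution calculus):
`sub t x u` is the explicit substitution `t[x←u]`, binding `x` in `t`. -/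
inductive VTerm : Type
  | var : ℕ → VTerm
  | lam : ℕ → VTerm → VTerm
  | app : VTerm → VTerm → VTerm
  | sub : VTerm → ℕ → VTerm → VTerm

/-- Values `v ::= x | λx.t`. -/
def VTerm.isValue : VTerm → Prop
  | .var _ => True
  | .lam _ _ => True
  | .app _ _ => False
  | .sub _ _ _ => False

/-- Free variables. -/
def VTerm.fv : VTerm → Finset ℕ
  | .var x => {x}
  | .lam x t => VTerm.fv t \ {x}
  | .app t u => VTerm.fv t ∪ VTerm.fv u
  | .sub t x u => (VTerm.fv t \ {x}) ∪ VTerm.fv u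

/-- Meta-level substitution `t{x:=v}`. -/
def VTerm.subst : VTerm → ℕ → VTerm → VTerm
  | .var y, x, v => if y = x then v else .var y
  | .lam y t, x, v => if y = x then .lam y t else .lam y (VTerm.subst t x v)
  | .app t u, x, v => .app (VTerm.subst t x v) (VTerm.subst u x v)
  | .sub t y u, x, v =>
      if y = x then .sub t y (VTerm.subst u x v)
      else .sub (VTerm.subst t x v) y (VTerm.subst u x v)

/-- List contexts `L ::= ⟨⟩ | L[x←t]`. -/
inductive VLCtx : Type
  | hole : VLCtx
  | sub : VLCtx → ℕ → VTerm → VLCtx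

def VLCtx.plug : VLCtx → VTerm → VTerm
  | .hole, t => t
  | .sub L x u, t => VTerm.sub (VLCtx.plug L t) x u

def VLCtx.binders : VLCtx → Finset ℕ
  | .hole => ∅
  | .sub L x _ => insert x (VLCtx.binders L)

/-- Root rewrite rules (βv) and (sv); the side conditions say that no free
variable is captured by the list context `L`. -/
inductive VRoot : VTerm → VTerm → Prop
  | beta (L : VLCtx) (x : ℕ) (s t : VTerm)
      (hcap : ∀ y ∈ VLCtx.binders L, y ∉ VTerm.fv t) :
      VRoot (.app (VLCtx.plug L (.lam x s)) t) (VLCtx.plug L (.sub s x t))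
  | subv (L : VLCtx) (t : VTerm) (x : ℕ) (v : VTerm)
      (hv : VTerm.isValue v)
      (hcap : ∀ y ∈ VLCtx.binders L, y ∉ VTerm.fv t \ {x}) :
      VRoot (.sub t x (VLCtx.plug L v)) (VLCtx.plug L (VTerm.subst t x v))

/-- Stratified reduction `→_{v_k}` for `k ∈ ℕ∪{ω}`, where `ω` is `⊤ : ℕ∞`:
the closure of the root rules under stratified contexts `S_k`.  The `lam`
rule raises the level by one; since `⊤ + 1 = ⊤`, level `⊤` (i.e. `ω`, full
reduction) allows reduction anywhere, while level `0` (surface reduction)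
forbids reduction under abstractions. -/
inductive VStep : ℕ∞ → VTerm → VTerm → Prop
  | root (k : ℕ∞) {t u : VTerm} : VRoot t u → VStep k t u
  | appL {k : ℕ∞} {t t' : VTerm} (u : VTerm) :
      VStep k t t' → VStep k (.app t u) (.app t' u)
  | appR {k : ℕ∞} (t : VTerm) {u u' : VTerm} :
      VStep k u u' → VStep k (.app t u) (.app t u')
  | subL {k : ℕ∞} {t t' : VTerm} (x : ℕ) (u : VTerm) :
      VStep k t t' → VStep k (.sub t x u) (.sub t' x u)
  | subR {k : ℕ∞} (t : VTerm) (x : ℕ) {u u' : VTerm} :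
      VStep k u u' → VStep k (.sub t x u) (.sub t x u')
  | lam {k : ℕ∞} (x : ℕ) {t t' : VTerm} :
      VStep k t t' → VStep (k + 1) (.lam x t) (.lam x t')

/-- `S_k`-normal terms: no `→_{v_k}` step applies. -/
def VNormal (k : ℕ∞) (t : VTerm) : Prop := ∀ u, ¬ VStep k t u

/-- Testing contexts `T ::= ⟨⟩ | T u | (λx.T) u`. -/
inductive VTCtx : Type
  | hole : VTCtx
  | app : VTCtx → VTerm → VTCtx
  | lamApp : ℕ → VTCtx → VTerm → VTCtx

def VTCtx.plug : VTCtx → VTerm → VTerm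
  | .hole, t => t
  | .app T u, t => .app (VTCtx.plug T t) u
  | .lamApp x T u, t => .app (.lam x (VTCtx.plug T t)) u

/-- A term is meaningful if some testing context sends it to a value by
surface reduction; otherwise it is meaningless. -/
def VMeaningful (t : VTerm) : Prop :=
  ∃ (T : VTCtx) (v : VTerm), VTerm.isValue v ∧
    Relation.ReflTransGen (VStep 0) (VTCtx.plug T t) v

/-- Full (one-hole) contexts `C ::= ⟨⟩ | λx.C | C t | t C | C[x←t] | t[x←C]`. -/
inductive VFCtx : Type
  | hole : VFCtx
  | lam : ℕ → VFCtx → VFCtx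
  | appL : VFCtx → VTerm → VFCtx
  | appR : VTerm → VFCtx → VFCtx
  | subL : VFCtx → ℕ → VTerm → VFCtx
  | subR : VTerm → ℕ → VFCtx → VFCtx

def VFCtx.plug : VFCtx → VTerm → VTerm
  | .hole, t => t
  | .lam x C, t => .lam x (VFCtx.plug C t)
  | .appL C u, t => .app (VFCtx.plug C t) u
  | .appR u C, t => .app u (VFCtx.plug C t)
  | .subL C x u, t => .sub (VFCtx.plug C t) x u
  | .subR u x C, t => .sub u x (VFCtx.plug C t)

/-- Partial terms: terms extended with the constant `⊥`. -/
inductive PVTerm : Type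
  | bot : PVTerm
  | var : ℕ → PVTerm
  | lam : ℕ → PVTerm → PVTerm
  | app : PVTerm → PVTerm → PVTerm
  | sub : PVTerm → ℕ → PVTerm → PVTerm

/-- Partial values `V ::= x | λx.T`. -/
def PVTerm.isValue : PVTerm → Prop
  | .var _ => True
  | .lam _ _ => True
  | _ => False

def PVTerm.fv : PVTerm → Finset ℕ
  | .bot => ∅
  | .var x => {x}
  | .lam x t => PVTerm.fv t \ {x}
  | .app t u => PVTerm.fv t ∪ PVTerm.fv u
  | .sub t x u => (PVTerm.fv t \ {x}) ∪ PVTerm.fv u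

def PVTerm.subst : PVTerm → ℕ → PVTerm → PVTerm
  | .bot, _, _ => .bot
  | .var y, x, v => if y = x then v else .var y
  | .lam y t, x, v => if y = x then .lam y t else .lam y (PVTerm.subst t x v)
  | .app t u, x, v => .app (PVTerm.subst t x v) (PVTerm.subst u x v)
  | .sub t y u, x, v =>
      if y = x then .sub t y (PVTerm.subst u x v)
      else .sub (PVTerm.subst t x v) y (PVTerm.subst u x v)

/-- Embedding of terms into partial terms. -/
def VTerm.toP : VTerm → PVTerm
  | .var x => .var x
  | .lam x t => .lam x (VTerm.toP t)
  | .app t u => .app (VTerm.toP t) (VTerm.toP u)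
  | .sub t x u => .sub (VTerm.toP t) x (VTerm.toP u)

/-- Partial list contexts. -/
inductive PVLCtx : Type
  | hole : PVLCtx
  | sub : PVLCtx → ℕ → PVTerm → PVLCtx

def PVLCtx.plug : PVLCtx → PVTerm → PVTerm
  | .hole, t => t
  | .sub L x u, t => PVTerm.sub (PVLCtx.plug L t) x u

def PVLCtx.binders : PVLCtx → Finset ℕ
  | .hole => ∅
  | .sub L x _ => insert x (PVLCtx.binders L)

/-- Root rewrite rules (βv) and (sv) on partial terms. -/
inductive PVRoot : PVTerm → PVTerm → Prop
  | beta (L : PVLCtx) (x : ℕ) (s t : PVTerm)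
      (hcap : ∀ y ∈ PVLCtx.binders L, y ∉ PVTerm.fv t) :
      PVRoot (.app (PVLCtx.plug L (.lam x s)) t) (PVLCtx.plug L (.sub s x t))
  | subv (L : PVLCtx) (t : PVTerm) (x : ℕ) (v : PVTerm)
      (hv : PVTerm.isValue v)
      (hcap : ∀ y ∈ PVLCtx.binders L, y ∉ PVTerm.fv t \ {x}) :
      PVRoot (.sub t x (PVLCtx.plug L v)) (PVLCtx.plug L (PVTerm.subst t x v))

/-- Partial stratified reduction `→_{v_k}` on partial terms. -/
inductive PVStep : ℕ∞ → PVTerm → PVTerm → Prop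
  | root (k : ℕ∞) {t u : PVTerm} : PVRoot t u → PVStep k t u
  | appL {k : ℕ∞} {t t' : PVTerm} (u : PVTerm) :
      PVStep k t t' → PVStep k (.app t u) (.app t' u)
  | appR {k : ℕ∞} (t : PVTerm) {u u' : PVTerm} :
      PVStep k u u' → PVStep k (.app t u) (.app t u')
  | subL {k : ℕ∞} {t t' : PVTerm} (x : ℕ) (u : PVTerm) :
      PVStep k t t' → PVStep k (.sub t x u) (.sub t' x u)
  | subR {k : ℕ∞} (t : PVTerm) (x : ℕ) {u u' : PVTerm} :
      PVStep k u u' → PVStep k (.sub t x u) (.sub t x u')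
  | lam {k : ℕ∞} (x : ℕ) {t t' : PVTerm} :
      PVStep k t t' → PVStep (k + 1) (.lam x t) (.lam x t')

/-- Partial full (one-hole) contexts. -/
inductive PVFCtx : Type
  | hole : PVFCtx
  | lam : ℕ → PVFCtx → PVFCtx
  | appL : PVFCtx → PVTerm → PVFCtx
  | appR : PVTerm → PVFCtx → PVFCtx
  | subL : PVFCtx → ℕ → PVTerm → PVFCtx
  | subR : PVTerm → ℕ → PVFCtx → PVFCtx

def PVFCtx.plug : PVFCtx → PVTerm → PVTerm
  | .hole, t => t
  | .lam x C, t => .lam x (PVFCtx.plug C t)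
  | .appL C u, t => .app (PVFCtx.plug C t) u
  | .appR u C, t => .app u (PVFCtx.plug C t)
  | .subL C x u, t => .sub (PVFCtx.plug C t) x u
  | .subR u x C, t => .sub u x (PVFCtx.plug C t)

/-- Approximation order on partial terms: the closure of `⊥ ≤ T` under all
partial full contexts, reflexivity and transitivity. -/
inductive PLe : PVTerm → PVTerm → Prop
  | bot (C : PVFCtx) (T : PVTerm) : PLe (PVFCtx.plug C .bot) (PVFCtx.plug C T)
  | refl (T : PVTerm) : PLe T T
  | trans {T U S : PVTerm} : PLe T U → PLe U S → PLe T S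

open Classical in
-- The meaningful approximant `A(t)`: `⊥` if `t` is meaningless, and defined
-- structurally otherwise.
noncomputable def VApprox : VTerm → PVTerm
  | .var x => if VMeaningful (.var x) then .var x else .bot
  | .lam x t => if VMeaningful (.lam x t) then .lam x (VApprox t) else .bot
  | .app t u => if VMeaningful (.app t u) then .app (VApprox t) (VApprox u) else .bot
  | .sub t x u => if VMeaningful (.sub t x u) then .sub (VApprox t) x (VApprox u) else .bot

mutual
  /-- Grammar `bvr_k` on partial terms. -/
  inductive PBvr : ℕ∞ → PVTerm → Prop
    | var (k : ℕ∞) (x : ℕ) : PBvr k (.var x)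
    | sub {k : ℕ∞} {t : PVTerm} (x : ℕ) {u : PVTerm} :
        PBvr k t → PBne k u → PBvr k (.sub t x u)
  /-- Grammar `bne_k` on partial terms. -/
  inductive PBne : ℕ∞ → PVTerm → Prop
    | appVr {k : ℕ∞} {t u : PVTerm} : PBvr k t → PBno k u → PBne k (.app t u)
    | appNe {k : ℕ∞} {t u : PVTerm} : PBne k t → PBno k u → PBne k (.app t u)
    | sub {k : ℕ∞} {t : PVTerm} (x : ℕ) {u : PVTerm} :
        PBne k t → PBne k u → PBne k (.sub t x u)
  /-- Grammar `bno_k` of partial `S_k`-normal forms without `⊥` at depth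
  `k`.  `lam0` is the level-`0` clause `λx.T` (arbitrary partial body);
  `lamS` covers levels `i+1` and `ω` (since `⊤ + 1 = ⊤`). -/
  inductive PBno : ℕ∞ → PVTerm → Prop
    | lam0 (x : ℕ) (T : PVTerm) : PBno 0 (.lam x T)
    | lamS {k : ℕ∞} (x : ℕ) {t : PVTerm} : PBno k t → PBno (k + 1) (.lam x t)
    | vr {k : ℕ∞} {t : PVTerm} : PBvr k t → PBno k t
    | ne {k : ℕ∞} {t : PVTerm} : PBne k t → PBno k t
    | sub {k : ℕ∞} {t : PVTerm} (x : ℕ) {u : PVTerm} :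
        PBno k t → PBne k u → PBno k (.sub t x u)
end

/-- Stratified equality `≡_k` on partial terms: terms are compared up to
depth `k`; at level `0` abstraction bodies (and binders) are ignored, and
`lamS` covers levels `i+1` and `ω` (since `⊤ + 1 = ⊤`). -/
inductive PEq : ℕ∞ → PVTerm → PVTerm → Prop
  | var (k : ℕ∞) (x : ℕ) : PEq k (.var x) (.var x)
  | app {k : ℕ∞} {t₁ u₁ t₂ u₂ : PVTerm} :
      PEq k t₁ u₁ → PEq k t₂ u₂ → PEq k (.app t₁ t₂) (.app u₁ u₂)
  | sub {k : ℕ∞} {t₁ u₁ t₂ u₂ : PVTerm} (x : ℕ) :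
      PEq k t₁ u₁ → PEq k t₂ u₂ → PEq k (.sub t₁ x t₂) (.sub u₁ x u₂)
  | lam0 (x y : ℕ) (t u : PVTerm) : PEq 0 (.lam x t) (.lam y u)
  | lamS {k : ℕ∞} (x : ℕ) {t u : PVTerm} :
      PEq k t u → PEq (k + 1) (.lam x t) (.lam x u)

/-- Anything above a variable is that variable. -/
theorem PLe.eq_var {T U : PVTerm} (h : PLe T U) :
    ∀ {x : ℕ}, T = .var x → U = .var x := by
  induction h with
  | bot C T => intro x hx; cases C <;> simp [PVFCtx.plug] at hx
  | refl T => exact fun hx => hx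
  | trans _ _ ih₁ ih₂ => exact fun hx => ih₂ (ih₁ hx)

/-- Anything above an abstraction is an abstraction with a larger body. -/
theorem PLe.exists_lam {T U : PVTerm} (h : PLe T U) :
    ∀ {x : ℕ} {t : PVTerm}, T = .lam x t → ∃ t', U = .lam x t' ∧ PLe t t' := by
  induction h with
  | bot C S =>
    intro x t hx
    cases C <;> simp only [PVFCtx.plug, PVTerm.lam.injEq, reduceCtorEq] at hx
    obtain ⟨rfl, rfl⟩ := hx
    exact ⟨_, rfl, .bot _ _⟩
  | refl T => exact fun hx => ⟨_, hx, .refl _⟩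
  | trans _ _ ih₁ ih₂ =>
    intro x t hx
    obtain ⟨t', h', hle⟩ := ih₁ hx
    obtain ⟨t'', h'', hle'⟩ := ih₂ h'
    exact ⟨t'', h'', hle.trans hle'⟩

/-- Anything above an application is an application of larger terms. -/
theorem PLe.exists_app {T U : PVTerm} (h : PLe T U) :
    ∀ {t u : PVTerm}, T = .app t u → ∃ t' u', U = .app t' u' ∧ PLe t t' ∧ PLe u u' := by
  induction h with
  | bot C S =>
    intro t u hx
    cases C <;> simp only [PVFCtx.plug, PVTerm.app.injEq, reduceCtorEq] at hx
    · obtain ⟨rfl, rfl⟩ := hx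
      exact ⟨_, _, rfl, .bot _ _, .refl _⟩
    · obtain ⟨rfl, rfl⟩ := hx
      exact ⟨_, _, rfl, .refl _, .bot _ _⟩
  | refl T => exact fun hx => ⟨_, _, hx, .refl _, .refl _⟩
  | trans _ _ ih₁ ih₂ =>
    intro t u hx
    obtain ⟨t', u', h', ht, hu⟩ := ih₁ hx
    obtain ⟨t'', u'', h'', ht', hu'⟩ := ih₂ h'
    exact ⟨t'', u'', h'', ht.trans ht', hu.trans hu'⟩

/-- Anything above an explicit substitution is an explicit substitution on larger terms. -/
theorem PLe.exists_sub {T U : PVTerm} (h : PLe T U) :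
    ∀ {t u : PVTerm} {x : ℕ}, T = .sub t x u →
      ∃ t' u', U = .sub t' x u' ∧ PLe t t' ∧ PLe u u' := by
  induction h with
  | bot C S =>
    intro t u x hx
    cases C <;> simp only [PVFCtx.plug, PVTerm.sub.injEq, reduceCtorEq] at hx
    · obtain ⟨rfl, rfl, rfl⟩ := hx
      exact ⟨_, _, rfl, .bot _ _, .refl _⟩
    · obtain ⟨rfl, rfl, rfl⟩ := hx
      exact ⟨_, _, rfl, .refl _, .bot _ _⟩
  | refl T => exact fun hx => ⟨_, _, hx, .refl _, .refl _⟩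
  | trans _ _ ih₁ ih₂ =>
    intro t u x hx
    obtain ⟨t', u', h', ht, hu⟩ := ih₁ hx
    obtain ⟨t'', u'', h'', ht', hu'⟩ := ih₂ h'
    exact ⟨t'', u'', h'', ht.trans ht', hu.trans hu'⟩

mutual
  /-- Stability of `bvr_k` under the approximation order. -/
  theorem PBvr.stable {k : ℕ∞} {T U : PVTerm} (hT : PBvr k T) (hle : PLe T U) :
      PBvr k U ∧ PEq k T U := by
    cases hT with
    | var k x => rw [hle.eq_var rfl]; exact ⟨.var _ _, .var _ _⟩
    | sub x ht hu =>
      obtain ⟨t', u', rfl, hlt, hlu⟩ := hle.exists_sub rfl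
      have ⟨ht', et⟩ := PBvr.stable ht hlt
      have ⟨hu', eu⟩ := PBne.stable hu hlu
      exact ⟨.sub x ht' hu', .sub x et eu⟩

  /-- Stability of `bne_k` under the approximation order. -/
  theorem PBne.stable {k : ℕ∞} {T U : PVTerm} (hT : PBne k T) (hle : PLe T U) :
      PBne k U ∧ PEq k T U := by
    cases hT with
    | appVr ht hu =>
      obtain ⟨t', u', rfl, hlt, hlu⟩ := hle.exists_app rfl
      have ⟨ht', et⟩ := PBvr.stable ht hlt
      have ⟨hu', eu⟩ := PBno.stable hu hlu
      exact ⟨.appVr ht' hu', .app et eu⟩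
    | appNe ht hu =>
      obtain ⟨t', u', rfl, hlt, hlu⟩ := hle.exists_app rfl
      have ⟨ht', et⟩ := PBne.stable ht hlt
      have ⟨hu', eu⟩ := PBno.stable hu hlu
      exact ⟨.appNe ht' hu', .app et eu⟩
    | sub x ht hu =>
      obtain ⟨t', u', rfl, hlt, hlu⟩ := hle.exists_sub rfl
      have ⟨ht', et⟩ := PBne.stable ht hlt
      have ⟨hu', eu⟩ := PBne.stable hu hlu
      exact ⟨.sub x ht' hu', .sub x et eu⟩

  /-- Stability of `bno_k` under the approximation order. -/
  theorem PBno.stable {k : ℕ∞} {T U : PVTerm} (hT : PBno k T) (hle : PLe T U) :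
      PBno k U ∧ PEq k T U := by
    cases hT with
    | lam0 x T =>
      obtain ⟨t', rfl, -⟩ := hle.exists_lam rfl
      exact ⟨.lam0 _ _, .lam0 _ _ _ _⟩
    | lamS x ht =>
      obtain ⟨t', rfl, hlt⟩ := hle.exists_lam rfl
      have ⟨ht', et⟩ := PBno.stable ht hlt
      exact ⟨.lamS x ht', .lamS x et⟩
    | vr ht =>
      have ⟨ht', et⟩ := PBvr.stable ht hle
      exact ⟨.vr ht', et⟩
    | ne ht =>
      have ⟨ht', et⟩ := PBne.stable ht hle
      exact ⟨.ne ht', et⟩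
    | sub x ht hu =>
      obtain ⟨t', u', rfl, hlt, hlu⟩ := hle.exists_sub rfl
      have ⟨ht', et⟩ := PBno.stable ht hlt
      have ⟨hu', eu⟩ := PBne.stable hu hlu
      exact ⟨.sub x ht' hu', .sub x et eu⟩
end

/-- (λvsub Stability of Meaningful Observables) If
`T ∈ bno_k` and `T ≤ U`, then `U ∈ bno_k` and `T ≡_k U`. -/
theorem vsub_stability_meaningful_observables (k : ℕ∞) (T U : PVTerm)
    (hT : PBno k T) (hle : PLe T U) :
    PBno k U ∧ PEq k T U :=
  hT.stable hle
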